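/- For every rewb α over Σ, there exist m ∈ ℕ⁺ and a unary m-PMCFG G over Σ such that L(G) = L(α). -/

import Mathlib

namespace Rewbs

/-- Extended alphabet Δ = Σ ⊎ B ⊎ ℕ⁺ : ordinary characters, brackets `[_i`, `]_i`,
and number characters (references). -/
inductive RSym (A : Type) : Type where
  | ch : A → RSym A
  | open_ : ℕ+ → RSym A
  | close : ℕ+ → RSym A
  | ref : ℕ+ → RSym A

/-- The alphabet Σ ⊎ B (no number characters). -/
inductive BSym (A : Type) : Type where
  | ch : A → BSym A
  | open_ : ℕ+ → BSym A
  | close : ℕ+ → BSym A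

/-- The homomorphism g : (Σ ⊎ B)* → Σ* erasing brackets. -/
def projB {A : Type} (v : List (BSym A)) : List A :=
  v.filterMap fun c => match c with
    | .ch a => some a
    | _ => none

/-- The fetching function fet_i. -/
noncomputable def fet {A : Type} (i : ℕ+) (v : List (BSym A)) : List A :=
  letI : DecidableEq (BSym A) := Classical.decEq _
  if BSym.open_ i ∈ v then
    projB (((v.reverse.takeWhile (fun c => decide (c ≠ BSym.open_ i))).reverse).takeWhile
      (fun c => decide (c ≠ BSym.close i)))
  else []

/-- One step of the pre-dereferencing function (processing one character, appended
at the right of the already-processed string). -/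
noncomputable def derefStep {A : Type} (acc : List (BSym A)) : RSym A → List (BSym A)
  | .ch a => acc ++ [BSym.ch a]
  | .open_ i => acc ++ [BSym.open_ i]
  | .close i => acc ++ [BSym.close i]
  | .ref i => acc ++ (fet i acc).map BSym.ch

/-- The pre-dereferencing function D : Δ* → (Σ ⊎ B)*. -/
noncomputable def preDeref {A : Type} (v : List (RSym A)) : List (BSym A) :=
  v.foldl derefStep []

/-- μ_i = fet_i ∘ D. -/
noncomputable def mu {A : Type} (i : ℕ+) (v : List (RSym A)) : List A :=
  fet i (preDeref v)

/-- deref = g ∘ D. -/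
noncomputable def deref {A : Type} (v : List (RSym A)) : List A :=
  projB (preDeref v)

/-- One step of the `open` function. -/
def openStep {A : Type} (s : Finset ℕ+) : RSym A → Finset ℕ+
  | .open_ i => insert i s
  | .close i => s.erase i
  | _ => s

/-- open : Δ* → finite subsets of ℕ⁺. -/
def openSet {A : Type} (v : List (RSym A)) : Finset ℕ+ :=
  v.foldl openStep ∅

/-- Syntax of regular expressions with backreferences (rewb). -/
inductive Rewb (A : Type) : Type where
  | ch : A → Rewb A
  | eps : Rewb A
  | backref : ℕ+ → Rewb A
  | cat : Rewb A → Rewb A → Rewb A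
  | alt : Rewb A → Rewb A → Rewb A
  | star : Rewb A → Rewb A
  | grp : ℕ+ → Rewb A → Rewb A

/-- `hasIdx i α` : the capturing group `(_i )_i` or the reference `\i` occurs in α. -/
def hasIdx {A : Type} (i : ℕ+) : Rewb A → Prop
  | .ch _ => False
  | .eps => False
  | .backref j => j = i
  | .cat r s => hasIdx i r ∨ hasIdx i s
  | .alt r s => hasIdx i r ∨ hasIdx i s
  | .star r => hasIdx i r
  | .grp j r => j = i ∨ hasIdx i r

/-- Well-formedness of a rewb: in `(_i α)_i`, the body α contains neither the
capturing group `(_i )_i` nor the reference `\i`. -/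
def Rewb.WF {A : Type} : Rewb A → Prop
  | .ch _ => True
  | .eps => True
  | .backref _ => True
  | .cat r s => r.WF ∧ s.WF
  | .alt r s => r.WF ∧ s.WF
  | .star r => r.WF
  | .grp i r => r.WF ∧ ¬ hasIdx i r

/-- The ref-language Ref(α) ⊆ Δ*. -/
def Ref {A : Type} : Rewb A → Language (RSym A)
  | .ch a => {[RSym.ch a]}
  | .eps => 1
  | .backref i => {[RSym.ref i]}
  | .cat r s => Ref r * Ref s
  | .alt r s => Ref r + Ref s
  | .star r => KStar.kstar (Ref r)
  | .grp i r => ({[RSym.open_ i]} : Language (RSym A)) * Ref r * ({[RSym.close i]} : Language (RSym A))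

/-- The language of a rewb: L(α) = deref(Ref(α)). -/
noncomputable def rewbLang {A : Type} (r : Rewb A) : Set (List A) :=
  deref '' (Ref r : Set (List (RSym A)))

/-- capt(α): the set of indices guaranteed to be captured. -/
def capt {A : Type} : Rewb A → Set ℕ+
  | .ch _ => ∅
  | .eps => ∅
  | .backref _ => ∅
  | .cat r s => capt r ∪ capt s
  | .alt r s => capt r ∩ capt s
  | .star r => capt r
  | .grp i r => capt r ∪ {i}

/-- The relation S ⊢ α. -/
def Sat {A : Type} : Rewb A → Set ℕ+ → Prop
  | .ch _, _ => True
  | .eps, _ => True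
  | .backref i, S => i ∈ S
  | .cat r s, S => Sat r S ∧ Sat s (S ∪ capt r)
  | .alt r s, S => Sat r S ∧ Sat s S
  | .star r, S => Sat r S
  | .grp _ r, S => Sat r S

/-- A rewb is closed if ∅ ⊢ α. -/
def Rewb.Closed {A : Type} (r : Rewb A) : Prop := Sat r ∅

/-- A rewb is closed-star if the body of every starred subexpression is closed. -/
def Rewb.ClosedStar {A : Type} : Rewb A → Prop
  | .ch _ => True
  | .eps => True
  | .backref _ => True
  | .cat r s => r.ClosedStar ∧ s.ClosedStar
  | .alt r s => r.ClosedStar ∧ s.ClosedStar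
  | .star r => r.ClosedStar ∧ r.Closed
  | .grp _ r => r.ClosedStar

/-- All indices (number characters and capturing-group indices) occurring in α are ≤ κ. -/
def Rewb.IdxLe {A : Type} (κ : ℕ) : Rewb A → Prop
  | .ch _ => True
  | .eps => True
  | .backref i => (i : ℕ) ≤ κ
  | .cat r s => r.IdxLe κ ∧ s.IdxLe κ
  | .alt r s => r.IdxLe κ ∧ s.IdxLe κ
  | .star r => r.IdxLe κ
  | .grp i r => (i : ℕ) ≤ κ ∧ r.IdxLe κ

/-- All indices occurring in a character of Δ are ≤ κ. -/
def RSym.idxLe {A : Type} (κ : ℕ) : RSym A → Prop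
  | .ch _ => True
  | .open_ i => (i : ℕ) ≤ κ
  | .close i => (i : ℕ) ≤ κ
  | .ref i => (i : ℕ) ≤ κ

/-! ### The tuple functions φ used in the unary-PMCFG construction -/

/-- The ℕ⁺ index corresponding to `j : Fin κ` (memory cell j+1). -/
def toP {κ : ℕ} (j : Fin κ) : ℕ+ := ⟨j.1 + 1, Nat.succ_pos _⟩

/-- φ_c^M : the input/paste/reset/identity functions on (κ+1)-tuples of strings. -/
def phi {A : Type} (κ : ℕ) (M : Finset ℕ+) :
    RSym A → (List A × (Fin κ → List A)) → (List A × (Fin κ → List A))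
  | RSym.ch a, (x, y) => (x ++ [a], fun j => if toP j ∈ M then y j ++ [a] else y j)
  | RSym.ref k, (x, y) =>
      let yk : List A := if h : k.1 ≤ κ ∧ 1 ≤ k.1 then y ⟨k.1 - 1, by omega⟩ else []
      (x ++ yk, fun j => if toP j ∈ M then y j ++ yk else y j)
  | RSym.open_ k, (x, y) => (x, fun j => if toP j = k then [] else y j)
  | RSym.close _, t => t

/-- Apply the functions φ_{v_r}^{open(prefix·v₁⋯v_r)} successively, left to right,
where `pref` is the already-processed prefix. -/
noncomputable def derefRun {A : Type} (κ : ℕ) :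
    List (RSym A) → List (RSym A) → (List A × (Fin κ → List A)) → (List A × (Fin κ → List A))
  | _, [], t => t
  | pref, c :: rest, t => derefRun κ (pref ++ [c]) rest (phi κ (openSet (pref ++ [c])) c t)

/-! ### The quantities t and s -/

/-- One (right-to-left) step of the t-sequence. -/
def tStep {A : Type} (c : RSym A) (t : ℕ+ → ℕ) : ℕ+ → ℕ :=
  match c with
  | .ch _ => t
  | .close _ => t
  | .open_ j => fun k => if k = j then 0 else t k
  | .ref j => fun k => if k = j then t k + 1 else t k

/-- `tOf suf k` is t_{i,k} where `suf` is the suffix v_{i+1} ⋯ v_m of v. -/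
def tOf {A : Type} : List (RSym A) → ℕ+ → ℕ
  | [] => fun _ => 0
  | c :: rest => tStep c (tOf rest)

/-- One (right-to-left) step of the s-sequence; `O` is open(v₁⋯v_i). -/
def sStep {A : Type} (O : Finset ℕ+) (c : RSym A) (s : ℕ+ → ℕ) : ℕ+ → ℕ :=
  match c with
  | .ch _ => s
  | .close _ => s
  | .open_ j => fun k => if k = j then 0 else s k
  | .ref j => fun k => if k = j then max (max 1 (s j)) (O.sup fun l => s l + 1) else s k

/-- `sOf pref suf k` is s_{i,k} where v = pref ++ suf and i = |pref|. -/
def sOf {A : Type} : List (RSym A) → List (RSym A) → ℕ+ → ℕ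
  | _, [] => fun _ => 0
  | pref, c :: rest => sStep (openSet (pref ++ [c])) c (sOf (pref ++ [c]) rest)

/-! ### Parallel multiple context-free grammars -/

/-- An item of an output component of a PMCFG function: a constant string
or the j-th component of the i-th argument. -/
inductive PItem (T : Type) : Type where
  | const : List T → PItem T
  | arg : ℕ → ℕ → PItem T

/-- A rule A → f[A₁,…,A_l] of a PMCFG, where f is given syntactically by the
lists of items of its output components. -/
structure PRule (T N : Type) : Type where
  lhs : N
  rhs : List N
  out : List (List (PItem T))

/-- A PMCFG with nonterminals `Fin n`. -/
structure PMCFG (T : Type) : Type where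
  n : ℕ
  dim : Fin n → ℕ
  start : Fin n
  rules : List (PRule T (Fin n))

/-- Evaluation of a single item, given the tuples derived from the arguments. -/
def evalItem {T : Type} (args : List (List (List T))) : PItem T → List T
  | .const c => c
  | .arg i j => (args.getD i []).getD j []

/-- Evaluation of one output component. -/
def evalItems {T : Type} (args : List (List (List T))) (items : List (PItem T)) : List T :=
  (items.map (evalItem args)).flatten

/-- The set L_G(A) of tuples derived from each nonterminal. -/
inductive PMCFG.Derives {T : Type} (G : PMCFG T) : Fin G.n → List (List T) → Prop
  | step (r : PRule T (Fin G.n)) (hr : r ∈ G.rules) (args : List (List (List T)))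
      (hargs : List.Forall₂ G.Derives r.rhs args) :
      G.Derives r.lhs (r.out.map (evalItems args))

/-- L(G) = L_G(S), identifying 1-tuples with strings. -/
def PMCFG.lang {T : Type} (G : PMCFG T) : Set (List T) :=
  {w | G.Derives G.start [w]}

/-- Well-formedness of a rule with respect to the dimension assignment. -/
def PRule.WFdim {T N : Type} (dim : N → ℕ) (r : PRule T N) : Prop :=
  r.out.length = dim r.lhs ∧
  ∀ items ∈ r.out, ∀ it ∈ items, ∀ i j, it = PItem.arg i j →
    ∃ h : i < r.rhs.length, j < dim (r.rhs.get ⟨i, h⟩)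

/-- G is a well-formed m-PMCFG. -/
def PMCFG.WF {T : Type} (G : PMCFG T) (m : ℕ) : Prop :=
  (∀ A : Fin G.n, 1 ≤ G.dim A ∧ G.dim A ≤ m) ∧ G.dim G.start = 1 ∧
  ∀ r ∈ G.rules, r.WFdim G.dim

/-- G is unary: every function takes at most one argument. -/
def PMCFG.Unary {T : Type} (G : PMCFG T) : Prop :=
  ∀ r ∈ G.rules, r.rhs.length ≤ 1

/-- The list of argument components referenced by a rule. -/
def PRule.argRefs {T N : Type} (r : PRule T N) : List (ℕ × ℕ) :=
  r.out.flatten.filterMap fun it => match it with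
    | .arg i j => some (i, j)
    | _ => none

/-- G is an MCFG: no rule uses the same argument component more than once. -/
def PMCFG.NonDup {T : Type} (G : PMCFG T) : Prop :=
  ∀ r ∈ G.rules, r.argRefs.Nodup

/-! ### Stack automata -/

/-- Direction of the stack pointer. -/
inductive SDir : Type where
  | left | stay | right
deriving DecidableEq

/-- A one-way nondeterministic stack automaton.  The input symbol `none`
denotes the endmarker ▷.  `push q a Z` is the pushdown mode (applicable when the
stack pointer is at the top symbol Z; the Bool is whether the input head moves
right); `read q a Z top` is the stack-reading mode (`top` tells whether the
pointed symbol Z is the topmost one). -/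
structure SA (T : Type) : Type 1 where
  Q : Type
  finQ : Fintype Q
  Γ : Type
  finΓ : Fintype Γ
  q0 : Q
  Z0 : Γ
  F : Set Q
  push : Q → Option T → Γ → Set (Q × Bool × List Γ)
  read : Q → Option T → Γ → Bool → Set (Q × Bool × SDir)

namespace SA

/-- Instantaneous description: state, remaining input (the endmarker ▷ is
implicit at the end), stack below-and-including the pointer, stack above the
pointer. -/
def Conf {T : Type} (M : SA T) : Type := M.Q × List T × List M.Γ × List M.Γ

/-- Move the stack pointer: the stack is γ ++ [Z] ++ above with the pointer on Z. -/
def moveStack {Γ : Type} : SDir → List Γ → Γ → List Γ → List Γ × List Γ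
  | .left, γ, Z, above => (γ, Z :: above)
  | .stay, γ, Z, above => (γ ++ [Z], above)
  | .right, γ, Z, b :: rest => (γ ++ [Z, b], rest)
  | .right, γ, Z, [] => (γ ++ [Z], [])

/-- One move of a stack automaton on instantaneous descriptions. -/
inductive Step {T : Type} (M : SA T) : M.Conf → M.Conf → Prop
  | push (q : M.Q) (u : List T) (γ : List M.Γ) (Z : M.Γ) (q' : M.Q) (d : Bool) (y : List M.Γ)
      (hmem : (q', d, y) ∈ M.push q u.head? Z)
      (hd : d = true → u ≠ []) :
      Step M (q, u, γ ++ [Z], []) (q', if d then u.tail else u, γ ++ y, [])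
  | read (q : M.Q) (u : List T) (γ : List M.Γ) (Z : M.Γ) (above : List M.Γ)
      (q' : M.Q) (d : Bool) (e : SDir)
      (hmem : (q', d, e) ∈ M.read q u.head? Z above.isEmpty)
      (hd : d = true → u ≠ [])
      (hleft : e = SDir.left → γ ≠ [])
      (hright : e = SDir.right → above ≠ []) :
      Step M (q, u, γ ++ [Z], above)
        (q', if d then u.tail else u, (moveStack e γ Z above).1, (moveStack e γ Z above).2)

/-- Acceptance: from (q₀, w▷, Z₀↑$) reach a final state with the whole input read. -/
def Accepts {T : Type} (M : SA T) (w : List T) : Prop :=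
  ∃ (qf : M.Q) (g1 g2 : List M.Γ), qf ∈ M.F ∧
    Relation.ReflTransGen (Step M) (M.q0, w, [M.Z0], []) (qf, [], g1, g2)

/-- The language of a stack automaton. -/
def lang {T : Type} (M : SA T) : Set (List T) := {w | M.Accepts w}

/-- Nonerasing: every pushdown-mode transition pushes a nonempty word. -/
def NonErasing {T : Type} (M : SA T) : Prop :=
  ∀ q a Z q' d y, (q', d, y) ∈ M.push q a Z → y ≠ []

end SA


/-! ### Regularity of the ref-language -/

theorem isRegular_singleton {T : Type} (w : List T) : Language.IsRegular ({w} : Language T) := by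
  apply Language.IsRegular.of_finite_range_leftQuotient
  refine (((List.finite_toSet w.tails).image
    (fun s => ({s} : Language T))).insert 0).subset ?_
  rintro _ ⟨u, rfl⟩
  by_cases h : u <+: w
  · obtain ⟨s, rfl⟩ := h
    refine .inr ⟨s, by simp, ?_⟩
    ext x
    exact ⟨fun h => by rw [show x = s from h]; rfl, fun h => List.append_cancel_left h⟩
  · refine .inl ?_
    ext x
    exact ⟨fun hx => h ⟨x, hx⟩, fun hx => absurd hx (Language.notMem_zero x)⟩

/-- The residuals of `L` by the suffixes of `w` whose complementary prefix lies in `K`. -/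
def suffixQuotients {T : Type} (K L : Language T) (w : List T) : Set (Language T) :=
  {Q | ∃ u v, w = u ++ v ∧ u ∈ K ∧ Q = L.leftQuotient v}

theorem finite_range_suffixQuotients {T : Type} (K : Language T) {L : Language T}
    (h : L.IsRegular) : (Set.range (suffixQuotients K L)).Finite := by
  refine h.finite_range_leftQuotient.finite_subsets.subset ?_
  rintro _ ⟨w, rfl⟩ Q ⟨u, v, -, -, rfl⟩
  exact ⟨v, rfl⟩

theorem leftQuotient_mul {T : Type} (K L : Language T) (w : List T) :
    (K * L).leftQuotient w = K.leftQuotient w * L + sSup (suffixQuotients K L w) := by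
  ext x
  simp only [Language.mem_leftQuotient, Language.mem_mul, Language.mem_add]
  constructor
  · rintro ⟨a, ha, b, hb, hab⟩
    rcases List.append_eq_append_iff.1 hab with ⟨v, rfl, rfl⟩ | ⟨c, rfl, rfl⟩
    · exact .inr ⟨_, ⟨a, v, rfl, ha, rfl⟩, hb⟩
    · exact .inl ⟨c, ha, b, hb, rfl⟩
  · rintro (⟨a, ha, b, hb, rfl⟩ | ⟨_, ⟨u, v, rfl, hu, rfl⟩, hx⟩)
    · exact ⟨_, ha, b, hb, by simp⟩
    · exact ⟨u, hu, _, hx, by simp⟩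

theorem isRegular_mul {T : Type} {K L : Language T} (hK : K.IsRegular) (hL : L.IsRegular) :
    (K * L).IsRegular := by
  apply Language.IsRegular.of_finite_range_leftQuotient
  refine (Set.Finite.image2 (fun P S => P * L + sSup S) hK.finite_range_leftQuotient
    (finite_range_suffixQuotients K hL)).subset ?_
  rintro _ ⟨w, rfl⟩
  exact ⟨_, ⟨w, rfl⟩, _, ⟨w, rfl⟩, (leftQuotient_mul K L w).symm⟩

/-- The language `{ε}` if `p` holds, and `∅` otherwise. -/
def epsIf (T : Type) (p : Prop) : Language T := {x : List T | x = [] ∧ p}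

theorem leftQuotient_kstar {T : Type} (L : Language T) (w : List T) :
    (KStar.kstar L).leftQuotient w =
      sSup (suffixQuotients (KStar.kstar L) L w) * KStar.kstar L +
        epsIf T (w ∈ KStar.kstar L) := by
  ext x
  constructor
  · intro hx
    obtain ⟨l, hl, hL⟩ := Language.mem_kstar.1 hx
    induction l generalizing w with
    | nil =>
      obtain ⟨rfl, rfl⟩ := List.append_eq_nil_iff.1 hl
      exact .inr ⟨rfl, Language.nil_mem_kstar L⟩
    | cons y l ih =>
      have hy := hL y (by simp)
      have hl' : ∀ z ∈ l, z ∈ L := fun z hz => hL z (by simp [hz])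
      rcases List.append_eq_append_iff.1 hl with ⟨a, rfl, rfl⟩ | ⟨c, rfl, hc⟩
      · exact .inl (Language.mem_mul.2 ⟨a, ⟨_, ⟨[], w, rfl, Language.nil_mem_kstar L, rfl⟩, hy⟩,
          l.flatten, Language.join_mem_kstar hl', rfl⟩)
      · have hyc : ∀ u ∈ KStar.kstar L, y ++ u ∈ KStar.kstar L := fun u hu => by
          obtain ⟨k, rfl, hk⟩ := Language.mem_kstar.1 hu
          exact Language.mem_kstar.2 ⟨y :: k, by simp, by simpa using ⟨hy, hk⟩⟩
        rcases ih c (Language.mem_kstar.2 ⟨l, hc.symm, hl'⟩) hc.symm hl' with h | ⟨rfl, h⟩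
        · obtain ⟨a, ⟨_, ⟨u, v, rfl, hu, rfl⟩, ha⟩, b, hb, rfl⟩ := Language.mem_mul.1 h
          exact .inl (Language.mem_mul.2
            ⟨a, ⟨_, ⟨y ++ u, v, by simp, hyc u hu, rfl⟩, ha⟩, b, hb, rfl⟩)
        · exact .inr ⟨rfl, hyc c h⟩
  · rintro (h | ⟨rfl, h⟩)
    · obtain ⟨a, ⟨_, ⟨u, v, rfl, hu, rfl⟩, ha⟩, b, hb, rfl⟩ := Language.mem_mul.1 h
      obtain ⟨k, rfl, hk⟩ := Language.mem_kstar.1 hu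
      obtain ⟨l, rfl, hl⟩ := Language.mem_kstar.1 hb
      refine Language.mem_kstar.2 ⟨k ++ (v ++ a) :: l, by simp, ?_⟩
      intro y hy
      rcases List.mem_append.1 hy with hy | hy
      · exact hk y hy
      · rcases List.mem_cons.1 hy with rfl | hy
        · exact ha
        · exact hl y hy
    · simpa using h

theorem isRegular_kstar {T : Type} {L : Language T} (hL : L.IsRegular) :
    (KStar.kstar L).IsRegular := by
  apply Language.IsRegular.of_finite_range_leftQuotient
  refine (Set.Finite.image2
    (fun S (p : Prop) => sSup S * KStar.kstar L + epsIf T p)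
    (finite_range_suffixQuotients (KStar.kstar L) hL) (Set.finite_univ)).subset ?_
  rintro _ ⟨w, rfl⟩
  exact ⟨_, ⟨w, rfl⟩, w ∈ KStar.kstar L, trivial, (leftQuotient_kstar L w).symm⟩

theorem isRegular_ref {A : Type} (α : Rewb A) : (Ref α).IsRegular := by
  induction α with
  | ch a => exact isRegular_singleton _
  | eps => exact isRegular_singleton _
  | backref i => exact isRegular_singleton _
  | cat r s hr hs => exact isRegular_mul hr hs
  | alt r s hr hs => exact hr.add hs
  | star r hr => exact isRegular_kstar hr
  | grp i r hr =>
    exact isRegular_mul (isRegular_mul (isRegular_singleton _) hr) (isRegular_singleton _)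

/-- The symbols over which the words of `Ref α` are built. -/
def Rewb.syms {A : Type} : Rewb A → List (RSym A)
  | .ch a => [.ch a]
  | .eps => []
  | .backref i => [.ref i]
  | .cat r s => r.syms ++ s.syms
  | .alt r s => r.syms ++ s.syms
  | .star r => r.syms
  | .grp i r => .open_ i :: .close i :: r.syms

theorem mem_syms_of_mem_ref {A : Type} (α : Rewb A) :
    ∀ v ∈ Ref α, ∀ c ∈ v, c ∈ α.syms := by
  induction α with
  | ch a => rintro _ rfl; simp [Rewb.syms]
  | eps => rintro _ rfl; simp
  | backref i => rintro _ rfl; simp [Rewb.syms]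
  | cat r s hr hs =>
    rintro v hv c hc
    obtain ⟨a, ha, b, hb, rfl⟩ := Language.mem_mul.1 hv
    rcases List.mem_append.1 hc with h | h
    · exact List.mem_append.2 (.inl (hr a ha c h))
    · exact List.mem_append.2 (.inr (hs b hb c h))
  | alt r s hr hs =>
    rintro v (hv | hv) c hc
    · exact List.mem_append.2 (.inl (hr v hv c hc))
    · exact List.mem_append.2 (.inr (hs v hv c hc))
  | star r hr =>
    rintro v hv c hc
    obtain ⟨l, rfl, hl⟩ := Language.mem_kstar.1 hv
    obtain ⟨y, hy, hcy⟩ := List.mem_flatten.1 hc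
    exact hr y (hl y hy) c hcy
  | grp i r hr =>
    rintro v hv c hc
    obtain ⟨a, ha, _, rfl, rfl⟩ := Language.mem_mul.1 hv
    obtain ⟨_, rfl, b, hb, rfl⟩ := Language.mem_mul.1 ha
    simp only [List.mem_append, List.mem_singleton] at hc
    rcases hc with (rfl | h) | rfl
    · simp [Rewb.syms]
    · simp [Rewb.syms, hr b hb c h]
    · simp [Rewb.syms]

open Classical in
/-- The part of `w` following the last `[_i`. -/
noncomputable def lastSegment {A : Type} (i : ℕ+) (w : List (BSym A)) : List (BSym A) :=
  (w.reverse.takeWhile (fun c => decide (c ≠ BSym.open_ i))).reverse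

open Classical in
theorem fet_eq {A : Type} (i : ℕ+) (w : List (BSym A)) :
    fet i w = if BSym.open_ i ∈ w then
      projB ((lastSegment i w).takeWhile (fun c => decide (c ≠ BSym.close i))) else [] := by
  unfold fet lastSegment
  congr

open Classical in
theorem lastSegment_append {A : Type} (i : ℕ+) (w : List (BSym A)) (c : BSym A) :
    lastSegment i (w ++ [c]) = if c = .open_ i then [] else lastSegment i w ++ [c] := by
  by_cases h : c = .open_ i <;> simp [lastSegment, h]

/-- The group `i` is open at the end of `w`. -/
def IsOpen {A : Type} (i : ℕ+) (w : List (BSym A)) : Prop :=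
  BSym.open_ i ∈ w ∧ BSym.close i ∉ lastSegment i w

theorem takeWhile_append_singleton {T : Type} (p : T → Bool) (l : List T) (c : T) :
    (l ++ [c]).takeWhile p =
      if (∀ x ∈ l, p x = true) ∧ p c = true then l ++ [c] else l.takeWhile p := by
  induction l with
  | nil => by_cases h : p c = true <;> simp [h]
  | cons a l ih => by_cases h : p a = true <;> simp [h, ih]; split_ifs <;> simp

open Classical in
theorem fet_append {A : Type} (i : ℕ+) (w : List (BSym A)) (c : BSym A) :
    fet i (w ++ [c]) =
      if c = .open_ i then [] else if IsOpen i w then fet i w ++ projB [c] else fet i w := by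
  by_cases h : c = .open_ i
  · simp [fet_eq, lastSegment_append, h, projB]
  have h' : BSym.open_ i ≠ c := fun e => h e.symm
  by_cases ho : BSym.open_ i ∈ w
  · simp [fet_eq, lastSegment_append, h, h', ho, takeWhile_append_singleton, IsOpen]
    by_cases hc : c = .close i
    · subst hc
      simp [projB]
    · by_cases hm : BSym.close i ∈ lastSegment i w
      · have : ¬ ∀ x ∈ lastSegment i w, ¬ x = BSym.close i := fun h => h _ hm rfl
        simp [this, hm]
      · have h1 : ∀ x ∈ lastSegment i w, ¬ x = BSym.close i := fun x hx e => hm (e ▸ hx)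
        rw [if_pos ⟨h1, hc⟩, if_neg hm, List.takeWhile_eq_self_iff.2 (by simpa using h1)]
        simp [projB]
  · simp [fet_eq, h, h', ho, IsOpen]


theorem isOpen_append {A : Type} (i : ℕ+) (w : List (BSym A)) (c : BSym A) :
    IsOpen i (w ++ [c]) ↔ c = .open_ i ∨ IsOpen i w ∧ c ≠ .close i := by
  by_cases h : c = .open_ i
  · simp [IsOpen, lastSegment_append, h]
  · have h' : BSym.open_ i ≠ c := fun e => h e.symm
    simp [IsOpen, lastSegment_append, h, h', and_assoc, eq_comm]

theorem isOpen_append_map {A : Type} (i : ℕ+) (w : List (BSym A)) (u : List A) :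
    IsOpen i (w ++ u.map .ch) ↔ IsOpen i w := by
  induction u using List.reverseRecOn with
  | nil => simp
  | append_singleton u a ih =>
    rw [List.map_append, ← List.append_assoc, List.map_singleton, isOpen_append, ih]
    simp

open Classical in
theorem fet_append_map {A : Type} (i : ℕ+) (w : List (BSym A)) (u : List A) :
    fet i (w ++ u.map .ch) = if IsOpen i w then fet i w ++ u else fet i w := by
  induction u using List.reverseRecOn with
  | nil => simp
  | append_singleton u a ih =>
    rw [List.map_append, ← List.append_assoc, List.map_singleton, fet_append, ih,
      isOpen_append_map]
    split_ifs <;> simp_all [projB]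

theorem projB_append_map {A : Type} (w : List (BSym A)) (u : List A) :
    projB (w ++ u.map .ch) = projB w ++ u := by
  induction u using List.reverseRecOn with
  | nil => simp
  | append_singleton u a ih =>
    rw [List.map_append, ← List.append_assoc, ← List.append_assoc, ← ih]
    simp [projB]

theorem preDeref_append {A : Type} (v : List (RSym A)) (c : RSym A) :
    preDeref (v ++ [c]) = derefStep (preDeref v) c := by
  simp [preDeref]

theorem openSet_append {A : Type} (v : List (RSym A)) (c : RSym A) :
    openSet (v ++ [c]) = openStep (openSet v) c := by
  simp [openSet]

theorem isOpen_preDeref {A : Type} (i : ℕ+) (v : List (RSym A)) :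
    IsOpen i (preDeref v) ↔ i ∈ openSet v := by
  induction v using List.reverseRecOn with
  | nil => simp [IsOpen, preDeref, openSet]
  | append_singleton v c ih =>
    rw [preDeref_append, openSet_append]
    cases c with
    | ch a => simp [derefStep, openStep, isOpen_append, ih]
    | open_ k => simp [derefStep, openStep, isOpen_append, ih, eq_comm]
    | close k => simp [derefStep, openStep, isOpen_append, ih, eq_comm, and_comm]
    | ref k => simp [derefStep, openStep, isOpen_append_map, ih]

/-! ### Tuples of captured strings -/

/-- Cell `0` holds the dereferenced string, cell `i > 0` the string captured by group `i`. -/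
noncomputable def cellVal {A : Type} (v : List (RSym A)) (j : ℕ) : List A :=
  if h : 0 < j then mu ⟨j, h⟩ v else deref v

theorem cellVal_coe {A : Type} (v : List (RSym A)) (i : ℕ+) : cellVal v i = mu i v := by
  simp only [cellVal, i.pos, dif_pos]
  rfl

theorem cellVal_zero {A : Type} (v : List (RSym A)) : cellVal v 0 = deref v := by
  simp [cellVal]

/-- The tuple of the cells `0, …, κ`. -/
noncomputable def cellTuple {A : Type} (κ : ℕ) (v : List (RSym A)) : List (List A) :=
  List.ofFn fun j : Fin (κ + 1) => cellVal v j

/-- The cells to which new characters are appended. -/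
def openCells {A : Type} (κ : ℕ) (v : List (RSym A)) : Set (Fin (κ + 1)) :=
  {j | ∀ i : ℕ+, (i : ℕ) = j → i ∈ openSet v}

/-- The effect of a symbol on the set of open cells. -/
def openCellsStep {A : Type} {κ : ℕ} (M : Set (Fin (κ + 1))) : RSym A → Set (Fin (κ + 1))
  | .ch _ => M
  | .ref _ => M
  | .open_ k => {j | (j : ℕ) = k ∨ j ∈ M}
  | .close k => {j | (j : ℕ) ≠ k ∧ j ∈ M}

theorem openCells_append {A : Type} (κ : ℕ) (v : List (RSym A)) (c : RSym A) :
    openCells κ (v ++ [c]) = openCellsStep (openCells κ v) c := by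
  ext j
  cases c with
  | ch a => simp [openCells, openCellsStep, openSet_append, openStep]
  | ref k => simp [openCells, openCellsStep, openSet_append, openStep]
  | open_ k =>
    simp only [openCells, openCellsStep, openSet_append, openStep, Set.mem_ofPred_eq,
      Finset.mem_insert]
    constructor
    · intro h
      by_cases hj : (j : ℕ) = k
      · exact .inl hj
      · refine .inr fun i hi => (h i hi).resolve_left fun e => hj (by rw [← hi, e])
    · rintro (h | h) i hi
      · exact .inl (PNat.coe_inj.1 (hi.trans h))
      · exact .inr (h i hi)
  | close k =>
    simp only [openCells, openCellsStep, openSet_append, openStep, Set.mem_ofPred_eq,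
      Finset.mem_erase]
    constructor
    · intro h
      exact ⟨fun hj => (h k hj.symm).1 rfl, fun i hi => (h i hi).2⟩
    · rintro ⟨h, h'⟩ i hi
      exact ⟨fun e => h (by rw [← hi, e]), h' i hi⟩

open Classical in
/-- The contents of cell `j` after reading a symbol, when the cells in `M` are open. -/
noncomputable def cellItems {A : Type} {κ : ℕ} (M : Set (Fin (κ + 1))) (j : Fin (κ + 1)) :
    RSym A → List (PItem A)
  | .ch a => if j ∈ M then [.arg 0 j, .const [a]] else [.arg 0 j]
  | .ref k => if j ∈ M then [.arg 0 j, .arg 0 k] else [.arg 0 j]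
  | .open_ k => if (j : ℕ) = k then [] else [.arg 0 j]
  | .close _ => [.arg 0 j]

theorem evalItem_arg {A : Type} (κ : ℕ) (v : List (RSym A)) (j : ℕ) (hj : j ≤ κ) :
    evalItem [cellTuple κ v] (.arg 0 j) = cellVal v j := by
  have : j < κ + 1 := by omega
  simp [evalItem, cellTuple, List.getD_eq_getElem?_getD, this, -List.ofFn_succ]

theorem evalItems_cellItems {A : Type} (κ : ℕ) (v : List (RSym A)) (c : RSym A)
    (hc : ∀ k, c = .ref k → (k : ℕ) ≤ κ) (j : Fin (κ + 1)) :
    evalItems [cellTuple κ v] (cellItems (openCells κ v) j c) = cellVal (v ++ [c]) j := by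
  have hj := evalItem_arg κ v j (by omega)
  obtain ⟨i, hi⟩ | h0 : (∃ i : ℕ+, (j : ℕ) = i) ∨ (j : ℕ) = 0 := by
    rcases Nat.eq_zero_or_pos j with h | h
    · exact .inr h
    · exact .inl ⟨⟨j, h⟩, rfl⟩
  · have hM : j ∈ openCells κ v ↔ IsOpen i (preDeref v) := by
      simp [openCells, isOpen_preDeref, hi]
    rw [hi, cellVal_coe, mu] at hj ⊢
    rw [preDeref_append]
    cases c with
    | ch a =>
      have ha : evalItem [cellTuple κ v] (.const [a]) = [a] := rfl
      by_cases h : IsOpen i (preDeref v) <;>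
        simp [cellItems, hM, h, evalItems, hi, hj, ha, derefStep, fet_append, projB]
    | ref k =>
      have hk := evalItem_arg κ v k (hc k rfl)
      rw [cellVal_coe, mu] at hk
      by_cases h : IsOpen i (preDeref v) <;>
        simp [cellItems, hM, h, evalItems, hi, hj, hk, derefStep, fet_append_map]
    | open_ k =>
      by_cases h : i = k
      · simp [cellItems, h, evalItems, hi, derefStep, fet_append]
      · have h' : k ≠ i := fun e => h e.symm
        simp [cellItems, h, h', evalItems, hi, hj, derefStep, fet_append, projB]
    | close k => simp [cellItems, evalItems, hi, hj, derefStep, fet_append, projB]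
  · have hM : j ∈ openCells κ v := fun i hi => absurd (hi.trans h0) i.ne_zero
    rw [h0, cellVal_zero, deref] at hj ⊢
    rw [preDeref_append]
    cases c with
    | ch a =>
      have ha : evalItem [cellTuple κ v] (.const [a]) = [a] := rfl
      simp only [cellItems, hM, evalItems, h0, derefStep]
      simp [hj, ha, projB]
    | ref k =>
      have hk := evalItem_arg κ v k (hc k rfl)
      rw [cellVal_coe, mu] at hk
      simp [cellItems, hM, evalItems, h0, hj, hk, derefStep, projB_append_map]
    | open_ k =>
      have h : 0 ≠ (k : ℕ) := k.ne_zero.symm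
      simp only [cellItems, h, evalItems, h0, derefStep]
      simp [hj, projB]
    | close k =>
      simp only [cellItems, evalItems, h0, derefStep]
      simp [hj, projB]

theorem eq_arg_of_mem_cellItems {A : Type} {κ : ℕ} {M : Set (Fin (κ + 1))} {j : Fin (κ + 1)}
    {c : RSym A} (hc : ∀ k, c = .ref k → (k : ℕ) ≤ κ) {a b : ℕ}
    (h : PItem.arg a b ∈ cellItems M j c) : a = 0 ∧ b < κ + 1 := by
  cases c with
  | ch _ =>
    unfold cellItems at h
    split_ifs at h <;> simp at h <;> omega
  | ref k =>
    have := hc k rfl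
    unfold cellItems at h
    split_ifs at h <;> simp at h <;> omega
  | open_ _ =>
    unfold cellItems at h
    split_ifs at h <;> simp at h <;> omega
  | close _ => simp [cellItems] at h; omega

/-! ### The grammar -/

theorem PMCFG.Derives.induct {T : Type} {G : PMCFG T} {P : Fin G.n → List (List T) → Prop}
    (h : ∀ r ∈ G.rules, ∀ args, List.Forall₂ P r.rhs args →
      P r.lhs (r.out.map (evalItems args))) {B : Fin G.n} {t : List (List T)}
    (hd : G.Derives B t) : P B t := by
  refine PMCFG.Derives.rec (motive_1 := fun B t _ => P B t)
    (motive_2 := fun l a _ => List.Forall₂ P l a) ?_ ?_ ?_ hd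
  · intro r hr args _ ih
    exact h r hr args ih
  · exact .nil
  · intro a b l l' _ _ h1 h2
    exact .cons h1 h2

theorem exists_ref_bound {A : Type} (l : List (RSym A)) :
    ∃ κ : ℕ, ∀ c ∈ l, ∀ k, c = .ref k → (k : ℕ) ≤ κ := by
  induction l with
  | nil => exact ⟨0, by simp⟩
  | cons c l ih =>
    obtain ⟨κ, h⟩ := ih
    cases c with
    | ref k =>
      refine ⟨max κ k, ?_⟩
      simp only [List.mem_cons, forall_eq_or_imp, RSym.ref.injEq, forall_eq', le_max_right,
        true_and]
      exact fun c hc i hi => (h c hc i hi).trans (le_max_left _ _)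
    | _ => exact ⟨κ, by simpa using h⟩

/-- The nonterminals: the start symbol, and the pairs of an automaton state and a set of open
cells. -/
abbrev NT (σ : Type) (κ : ℕ) : Type := Option (σ × Set (Fin (κ + 1)))

/-- The rule deriving the tuple of the empty word. -/
def initRule {A σ : Type} (D : DFA (RSym A) σ) (κ : ℕ) : PRule A (NT σ κ) where
  lhs := some (D.start, openCells κ ([] : List (RSym A)))
  rhs := []
  out := List.ofFn fun _ : Fin (κ + 1) => []

/-- The rule reading a symbol. -/
noncomputable def readRule {A σ : Type} (D : DFA (RSym A) σ) (κ : ℕ)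
    (p : (σ × Set (Fin (κ + 1))) × RSym A) : PRule A (NT σ κ) where
  lhs := some (D.step p.1.1 p.2, openCellsStep p.1.2 p.2)
  rhs := [some p.1]
  out := List.ofFn fun j => cellItems p.1.2 j p.2

/-- The rule extracting the dereferenced string. -/
def finalRule (A : Type) {σ : Type} (κ : ℕ) (p : σ × Set (Fin (κ + 1))) : PRule A (NT σ κ) where
  lhs := none
  rhs := [some p]
  out := [[.arg 0 0]]

/-- Renaming of nonterminals. -/
def PRule.map {T N N' : Type} (f : N → N') (r : PRule T N) : PRule T N' where
  lhs := f r.lhs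
  rhs := r.rhs.map f
  out := r.out

/-- The tuples which the grammar derives from a nonterminal. -/
def ntTuples {A σ : Type} (D : DFA (RSym A) σ) (κ : ℕ) (l : List (RSym A)) :
    NT σ κ → List (List A) → Prop
  | none, t => ∃ v, (∀ c ∈ v, c ∈ l) ∧ v ∈ D.accepts ∧ t = [deref v]
  | some p, t => ∃ v, (∀ c ∈ v, c ∈ l) ∧ p = (D.eval v, openCells κ v) ∧ t = cellTuple κ v

theorem cellTuple_nil {A : Type} (κ : ℕ) :
    cellTuple κ ([] : List (RSym A)) = List.ofFn fun _ : Fin (κ + 1) => [] := by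
  unfold cellTuple
  congr 1
  ext1 j
  simp [cellVal, mu, deref, preDeref, fet, projB]

theorem cellTuple_append {A : Type} (κ : ℕ) (v : List (RSym A)) (c : RSym A)
    (hc : ∀ k, c = .ref k → (k : ℕ) ≤ κ) :
    cellTuple κ (v ++ [c]) =
      (List.ofFn fun j => cellItems (openCells κ v) j c).map (evalItems [cellTuple κ v]) := by
  rw [List.map_ofFn, cellTuple]
  congr 1
  ext1 j
  exact (evalItems_cellItems κ v c hc j).symm

open Classical in
theorem exists_pmcfg_of_isRegular {A : Type} {L : Language (RSym A)} (hL : L.IsRegular)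
    (l : List (RSym A)) (hl : ∀ v ∈ L, ∀ c ∈ v, c ∈ l) :
    ∃ (m : ℕ) (G : PMCFG A), 1 ≤ m ∧ G.WF m ∧ G.Unary ∧
      G.lang = deref '' (L : Set (List (RSym A))) := by
  obtain ⟨σ, _, D, rfl⟩ := hL
  obtain ⟨κ, hκ⟩ := exists_ref_bound l
  obtain ⟨n, ⟨e⟩⟩ := Finite.exists_equiv_fin (NT σ κ)
  let states : List (σ × Set (Fin (κ + 1))) := Finset.univ.toList
  let G : PMCFG A :=
    { n := n
      dim := fun B => if e.symm B = none then 1 else κ + 1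
      start := e none
      rules := (initRule D κ).map e ::
        (((states ×ˢ l).map fun p => (readRule D κ p).map e) ++
          (states.filter fun p => p.1 ∈ D.accept).map fun p => (finalRule A κ p).map e) }
  have hrules : ∀ r, r ∈ G.rules ↔ r = (initRule D κ).map e ∨
      (∃ p c, c ∈ l ∧ r = (readRule D κ (p, c)).map e) ∨
      (∃ p, p.1 ∈ D.accept ∧ r = (finalRule A κ p).map e) := by
    intro r
    simp only [G, states, List.mem_cons, List.mem_append, List.mem_map, List.mem_filter,
      Finset.mem_toList, Finset.mem_univ, true_and, decide_eq_true_eq, eq_comm (b := r)]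
    refine or_congr_right (or_congr_left ⟨?_, ?_⟩)
    · rintro ⟨⟨p, c⟩, h, hr⟩
      exact ⟨p, c, (List.pair_mem_product.1 h).2, hr⟩
    · rintro ⟨p, c, h, hr⟩
      exact ⟨(p, c), List.pair_mem_product.2 ⟨by simp, h⟩, hr⟩
  have hsound : ∀ B t, G.Derives B t → ntTuples D κ l (e.symm B) t := by
    intro B t h
    refine PMCFG.Derives.induct (P := fun B t => ntTuples D κ l (e.symm B) t) ?_ h
    intro r hr args hargs
    rcases (hrules r).1 hr with rfl | ⟨p, c, hc, rfl⟩ | ⟨p, hp, rfl⟩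
    · refine (congrArg (ntTuples D κ l · _) (e.symm_apply_apply _)).mpr ?_
      refine ⟨[], by simp, rfl, ?_⟩
      rw [cellTuple_nil]
      simp [initRule, PRule.map, evalItems]
    · obtain ⟨t, ht, rfl⟩ : ∃ t, ntTuples D κ l (some p) t ∧ args = [t] := by
        simpa [readRule, PRule.map, List.forall₂_cons_left_iff] using hargs
      obtain ⟨v, hv, rfl, rfl⟩ := ht
      refine (congrArg (ntTuples D κ l · _) (e.symm_apply_apply _)).mpr ?_
      refine ⟨v ++ [c], ?_, ?_, ?_⟩
      · simpa [or_imp, forall_and] using ⟨hv, hc⟩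
      · simp [DFA.eval_append_singleton, openCells_append]
      · exact (cellTuple_append κ v c (hκ c hc)).symm
    · obtain ⟨t, ht, rfl⟩ : ∃ t, ntTuples D κ l (some p) t ∧ args = [t] := by
        simpa [finalRule, PRule.map, List.forall₂_cons_left_iff] using hargs
      obtain ⟨v, hv, rfl, rfl⟩ := ht
      refine (congrArg (ntTuples D κ l · _) (e.symm_apply_apply _)).mpr ?_
      refine ⟨v, hv, hp, ?_⟩
      simp [finalRule, PRule.map, evalItems, evalItem_arg, cellVal_zero]
  have hcomplete : ∀ v : List (RSym A), (∀ c ∈ v, c ∈ l) →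
      G.Derives (e (some (D.eval v, openCells κ v))) (cellTuple κ v) := by
    intro v
    induction v using List.reverseRecOn with
    | nil =>
      intro _
      have := PMCFG.Derives.step (G := G) _ ((hrules _).2 (.inl rfl)) [] .nil
      rw [cellTuple_nil]
      simpa [initRule, PRule.map, evalItems, List.map_ofFn, Function.comp_def] using this
    | append_singleton v c ih =>
      intro hv
      have hc : c ∈ l := hv c (by simp)
      have := PMCFG.Derives.step (G := G) _
        ((hrules _).2 (.inr (.inl ⟨(D.eval v, openCells κ v), c, hc, rfl⟩))) [cellTuple κ v]
        (.cons (ih fun d hd => hv d (by simp [hd])) .nil)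
      rw [cellTuple_append κ v c (hκ c hc), DFA.eval_append_singleton, openCells_append]
      exact this
  refine ⟨κ + 1, G, by omega, ⟨?_, ?_, ?_⟩, ?_, ?_⟩
  · intro B
    simp only [G]
    split_ifs <;> omega
  · simp [G]
  · intro r hr
    rcases (hrules r).1 hr with rfl | ⟨p, c, hc, rfl⟩ | ⟨p, hp, rfl⟩
    · refine ⟨by simp [G, initRule, PRule.map], ?_⟩
      intro items hi it hit i j h
      obtain ⟨_, rfl⟩ := (List.mem_ofFn' _ _).1 hi
      simp at hit
    · refine ⟨by simp [G, readRule, PRule.map], ?_⟩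
      rintro items hi _ hit i j rfl
      obtain ⟨q, rfl⟩ := (List.mem_ofFn' _ _).1 hi
      obtain ⟨rfl, hj⟩ := eq_arg_of_mem_cellItems (hκ c hc) hit
      exact ⟨by simp [readRule, PRule.map], by simpa [G, readRule, PRule.map] using hj⟩
    · refine ⟨by simp [G, finalRule, PRule.map], ?_⟩
      rintro items hi _ hit i j rfl
      obtain rfl := List.mem_singleton.1 hi
      obtain ⟨rfl, rfl⟩ : i = 0 ∧ j = 0 := by simpa using hit
      exact ⟨by simp [finalRule, PRule.map], by simp [G, finalRule, PRule.map]⟩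
  · intro r hr
    rcases (hrules r).1 hr with rfl | ⟨p, c, hc, rfl⟩ | ⟨p, hp, rfl⟩ <;>
      simp [initRule, readRule, finalRule, PRule.map]
  · ext w
    constructor
    · intro hw
      have h := hsound _ _ hw
      rw [show e.symm G.start = none from e.symm_apply_apply _] at h
      obtain ⟨v, -, hv, h⟩ := h
      exact ⟨v, hv, by simpa using h.symm⟩
    · rintro ⟨v, hv, rfl⟩
      have := PMCFG.Derives.step (G := G) _
        ((hrules _).2 (.inr (.inr ⟨(D.eval v, openCells κ v), hv, rfl⟩))) [cellTuple κ v]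
        (.cons (hcomplete v (hl v hv)) .nil)
      simpa [PMCFG.lang, finalRule, PRule.map, evalItems, evalItem_arg, cellVal_zero, G] using this

/-- Theorem rewbpmcfg. -/
theorem stmt8 {A : Type} (α : Rewb A) (hwf : α.WF) :
    ∃ (m : ℕ) (G : PMCFG A), 1 ≤ m ∧ G.WF m ∧ G.Unary ∧ G.lang = rewbLang α := by
  exact exists_pmcfg_of_isRegular (isRegular_ref α) α.syms (mem_syms_of_mem_ref α)

end Rewbs
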